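/- arXiv:0807.2198 — 5 statements merged into one kernel-verified Lean document; each statement's English description precedes it below -/
import Mathlib

section
/- Let k be a field, n ≥ 1, and M ∈ GL_n(k). Then M can be written as M = U·L with U an invertible upper triangular matrix and L an invertible lower triangular matrix if and only if for every r with 1 ≤ r ≤ n, the r×r submatrix of M formed by its last r rows and last r columns has nonzero determinant. -/
theorem gauss_UL_aux {k : Type*} [Field k] : ∀ (n : ℕ)
    (M : Matrix (Fin n) (Fin n) k),
    (∀ r : ℕ, 1 ≤ r → r ≤ n → ∀ e : Fin r → Fin n, (∀ i, (e i).val = n - r + i.val) →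
        (M.submatrix e e).det ≠ 0) →
    (∃ U L : Matrix (Fin n) (Fin n) k,
        IsUnit U ∧ IsUnit L ∧
        (∀ i j : Fin n, j < i → U i j = 0) ∧
        (∀ i j : Fin n, i < j → L i j = 0) ∧
        M = U * L) := by
  intro n
  induction n with
  | zero =>
    intro M _
    exact ⟨1, 1, isUnit_one, isUnit_one, fun i => i.elim0, fun i => i.elim0,
      by ext i; exact i.elim0⟩
  | succ n ih =>
    intro M h
    obtain ⟨U', L', hU', hL', hU, hL, hM'⟩ := ih (M.submatrix Fin.succ Fin.succ) (by
      intro r hr1 hr2 e he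
      exact h r hr1 (by omega) (fun i => (e i).succ) (fun i => by
        rw [Fin.val_succ, he]; omega))
    have hMu : IsUnit M.det := by
      have := h (n + 1) (by omega) le_rfl id (fun i => by simp)
      rw [isUnit_iff_ne_zero]
      exact this
    set x : Fin n → k := Matrix.vecMul (fun j => M 0 j.succ) L'⁻¹ with hx
    set y : Fin n → k := Matrix.mulVec U'⁻¹ (fun i => M i.succ 0) with hy
    have hxL : Matrix.vecMul x L' = fun j => M 0 j.succ := by
      rw [hx, Matrix.vecMul_vecMul, Matrix.nonsing_inv_mul _ ((Matrix.isUnit_iff_isUnit_det _).1 hL'),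
        Matrix.vecMul_one]
    have hUy : Matrix.mulVec U' y = fun i => M i.succ 0 := by
      rw [hy, Matrix.mulVec_mulVec, Matrix.mul_nonsing_inv _ ((Matrix.isUnit_iff_isUnit_det _).1 hU'),
        Matrix.one_mulVec]
    let U : Matrix (Fin (n + 1)) (Fin (n + 1)) k :=
      Matrix.of (Fin.cons (Fin.cons (M 0 0 - ∑ l, x l * y l) x) (fun i => Fin.cons 0 (U' i)))
    let L : Matrix (Fin (n + 1)) (Fin (n + 1)) k :=
      Matrix.of (Fin.cons (Fin.cons 1 (fun _ => 0)) (fun i => Fin.cons (y i) (L' i)))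
    have hUL : M = U * L := by
      ext i j
      rw [Matrix.mul_apply, Fin.sum_univ_succ]
      refine Fin.cases ?_ (fun i => ?_) i <;> refine Fin.cases ?_ (fun j => ?_) j
      · simp [U, L]
      · simpa [U, L, Matrix.vecMul, dotProduct] using (congrFun hxL j).symm
      · simpa [U, L, Matrix.mulVec, dotProduct] using (congrFun hUy i).symm
      · simpa [U, L, Matrix.mul_apply] using congrFun (congrFun hM' i) j
    have hd : IsUnit (U.det * L.det) := by rw [← Matrix.det_mul, ← hUL]; exact hMu
    refine ⟨U, L, (Matrix.isUnit_iff_isUnit_det _).2 (isUnit_of_mul_isUnit_left hd),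
      (Matrix.isUnit_iff_isUnit_det _).2 (isUnit_of_mul_isUnit_right hd), ?_, ?_, hUL⟩
    · intro i j
      refine Fin.cases ?_ (fun i => ?_) i <;> refine Fin.cases ?_ (fun j => ?_) j
      · simp
      · simp
      · simp [U]
      · simpa [U] using hU i j
    · intro i j
      refine Fin.cases ?_ (fun i => ?_) i <;> refine Fin.cases ?_ (fun j => ?_) j
      · simp
      · simp [L]
      · simp
      · simpa [L] using hL i j

/-- **Gauss decomposition and trailing principal minors.**
Let `k` be a field, `n ≥ 1`, and `M ∈ GL_n(k)`. Then `M = U * L` with `U` invertible upper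
triangular and `L` invertible lower triangular if and only if for every `1 ≤ r ≤ n` the
`r × r` submatrix of `M` formed by its last `r` rows and last `r` columns has nonzero
determinant. -/
theorem gauss_UL_iff_trailing_minors_ne_zero
    {k : Type*} [Field k] (n : ℕ) (hn : 1 ≤ n)
    (M : Matrix (Fin n) (Fin n) k) (hM : IsUnit M) :
    (∃ U L : Matrix (Fin n) (Fin n) k,
        IsUnit U ∧ IsUnit L ∧
        (∀ i j : Fin n, j < i → U i j = 0) ∧
        (∀ i j : Fin n, i < j → L i j = 0) ∧
        M = U * L) ↔
    (∀ r : ℕ, ∀ hr1 : 1 ≤ r, ∀ hr2 : r ≤ n,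
        (M.submatrix
            (fun i : Fin r => (⟨n - r + i.val, by have := i.isLt; omega⟩ : Fin n))
            (fun j : Fin r => (⟨n - r + j.val, by have := j.isLt; omega⟩ : Fin n))).det ≠ 0) := by
  refine ⟨?_, fun h => gauss_UL_aux n M fun r hr1 hr2 e he => ?_⟩
  swap
  · convert h r hr1 hr2 using 4 with i i
    · exact Fin.ext (he i)
    · exact Fin.ext (he i)
  rintro ⟨U, L, hU, hL, hUt, hLt, rfl⟩ r hr1 hr2
  have hdU := ((Matrix.isUnit_iff_isUnit_det _).1 hU).ne_zero
  have hdL := ((Matrix.isUnit_iff_isUnit_det _).1 hL).ne_zero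
  rw [Matrix.det_of_isUpperTriangular (fun i j hij => hUt i j hij), Finset.prod_ne_zero_iff] at hdU
  rw [Matrix.det_of_isLowerTriangular L (fun i j hij => hLt i j hij), Finset.prod_ne_zero_iff] at hdL
  set e : Fin r → Fin n := fun i => ⟨n - r + i.val, by have := i.isLt; omega⟩ with he
  have hinj : Function.Injective e := by
    intro a b hab
    have := congrArg Fin.val hab
    simp only [he] at this
    apply Fin.ext
    omega
  have hlt : ∀ a b : Fin r, a < b → e a < e b := by
    intro a b hab
    simp only [he, Fin.lt_def] at *
    omega
  have key : (U * L).submatrix e e = U.submatrix e e * L.submatrix e e := by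
    ext i j
    simp only [Matrix.submatrix_apply, Matrix.mul_apply]
    symm
    apply Fintype.sum_of_injective e hinj
    · intro l hl
      rw [hUt (e i) l, zero_mul]
      by_contra hc
      apply hl
      simp only [he, Fin.lt_def, not_lt] at hc
      refine ⟨⟨l.val - (n - r), by have := l.isLt; omega⟩, ?_⟩
      apply Fin.ext
      simp only [he]
      omega
    · intro l; rfl
  rw [key, Matrix.det_mul,
    Matrix.det_of_isUpperTriangular (M := U.submatrix e e) (fun i j hij => hUt _ _ (hlt _ _ hij)),
    Matrix.det_of_isLowerTriangular (L.submatrix e e) (fun i j hij => hLt _ _ (hlt _ _ hij))]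
  exact mul_ne_zero (Finset.prod_ne_zero_iff.2 fun i _ => hdU (e i) (Finset.mem_univ _))
    (Finset.prod_ne_zero_iff.2 fun i _ => hdL (e i) (Finset.mem_univ _))
end

section
/- Let k be a field, n ≥ 1, and M ∈ GL_n(k). Then M can be written as M = U₁·w₀·U₂ with U₁, U₂ invertible upper triangular matrices if and only if for every r with 1 ≤ r ≤ n, the r×r submatrix of M formed by its last r rows and first r columns has nonzero determinant. -/
open Matrix in
lemma bbc_sum {k : Type*} [Field k] {n r : ℕ} (hr : r ≤ n) (g : Fin n → k) (x : Fin r → k) :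
    ∑ l : Fin n, g l * (if h : (l : ℕ) < r then x ⟨l, h⟩ else 0)
      = ∑ j : Fin r, g (Fin.castLE hr j) * x j := by
  symm
  apply Finset.sum_of_injOn (Fin.castLE hr)
  · intro a _ b _ h
    simpa [Fin.ext_iff] using h
  · intro a _
    simp
  · intro i _ hi
    rw [dif_neg, mul_zero]
    intro h
    exact hi ⟨⟨i, h⟩, by simp, rfl⟩
  · intro i _
    simp [Fin.castLE]

lemma bbc_inv {k : Type*} [Field k] {n : ℕ} (U : Matrix (Fin n) (Fin n) k) (hU : IsUnit U)
    (h : ∀ i j : Fin n, j < i → U i j = 0) : ∀ i j : Fin n, j < i → U⁻¹ i j = 0 := by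
  have := hU.invertible
  have h2 : U.BlockTriangular id := fun i j hij => h i j hij
  have h3 := Matrix.blockTriangular_inv_of_blockTriangular h2
  exact fun i j hij => h3 hij

def bbcW (k : Type*) [Field k] (n : ℕ) : Matrix (Fin n) (Fin n) k :=
  Matrix.of fun i j : Fin n => if (j : ℕ) = n - 1 - (i : ℕ) then (1 : k) else 0

lemma bbcW_apply (k : Type*) [Field k] (n : ℕ) (i j : Fin n) :
    bbcW k n i j = if j = i.rev then 1 else 0 := by
  have : ((j : ℕ) = n - 1 - (i : ℕ)) ↔ j = i.rev := by
    rw [Fin.ext_iff, Fin.val_rev]; omega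
  simp [bbcW, this]

lemma bbcW_apply' (k : Type*) [Field k] (n : ℕ) (i j : Fin n) :
    bbcW k n i j = if i = j.rev then 1 else 0 := by
  rw [bbcW_apply]
  have : j = i.rev ↔ i = j.rev := by
    constructor <;> (rintro rfl; simp)
  simp [this]

lemma bbc_mulW {k : Type*} [Field k] {n : ℕ} (A : Matrix (Fin n) (Fin n) k) (i j : Fin n) :
    (A * bbcW k n) i j = A i j.rev := by
  simp [Matrix.mul_apply, bbcW_apply']

lemma bbc_Wvec {k : Type*} [Field k] {n : ℕ} (v : Fin n → k) (i : Fin n) :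
    (bbcW k n).mulVec v i = v i.rev := by
  simp [Matrix.mulVec, dotProduct, bbcW_apply]

lemma bbcW_sq (k : Type*) [Field k] (n : ℕ) : bbcW k n * bbcW k n = 1 := by
  ext i j
  rw [bbc_mulW, bbcW_apply', Fin.rev_rev, Matrix.one_apply]

lemma bbcW_unit (k : Type*) [Field k] (n : ℕ) : IsUnit (bbcW k n) :=
  IsUnit.of_mul_eq_one _ (bbcW_sq k n)

/-- **The big Bruhat cell of `GL_n`.**
Let `k` be a field, `n ≥ 1`, and `M ∈ GL_n(k)`. Then `M = U₁ * w₀ * U₂` with `U₁, U₂`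
invertible upper triangular matrices (where `w₀` is the antidiagonal permutation matrix)
if and only if for every `1 ≤ r ≤ n` the `r × r` submatrix of `M` formed by its last `r`
rows and first `r` columns has nonzero determinant. -/
theorem bruhat_big_cell_iff_antidiagonal_minors_ne_zero
    {k : Type*} [Field k] (n : ℕ) (hn : 1 ≤ n)
    (M : Matrix (Fin n) (Fin n) k) (hM : IsUnit M) :
    (∃ U₁ U₂ : Matrix (Fin n) (Fin n) k,
        IsUnit U₁ ∧ IsUnit U₂ ∧
        (∀ i j : Fin n, j < i → U₁ i j = 0) ∧
        (∀ i j : Fin n, j < i → U₂ i j = 0) ∧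
        M = U₁ * (Matrix.of fun i j : Fin n =>
          if (j : ℕ) = n - 1 - (i : ℕ) then (1 : k) else 0) * U₂) ↔
    (∀ r : ℕ, ∀ hr1 : 1 ≤ r, ∀ hr2 : r ≤ n,
        (M.submatrix
            (fun i : Fin r => (⟨n - r + i.val, by have := i.isLt; omega⟩ : Fin n))
            (fun j : Fin r => (⟨j.val, by have := j.isLt; omega⟩ : Fin n))).det ≠ 0) := by
  change (∃ U₁ U₂ : Matrix (Fin n) (Fin n) k,
        IsUnit U₁ ∧ IsUnit U₂ ∧
        (∀ i j : Fin n, j < i → U₁ i j = 0) ∧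
        (∀ i j : Fin n, j < i → U₂ i j = 0) ∧
        M = U₁ * bbcW k n * U₂) ↔ _
  constructor
  · rintro ⟨U₁, U₂, h1, h2, t1, t2, hMe⟩ r hr1 hr2 hdet
    obtain ⟨x, hx0, hx⟩ := Matrix.exists_mulVec_eq_zero_iff.mpr hdet
    apply hx0
    set X : Fin n → k := fun l => if h : (l : ℕ) < r then x ⟨l, h⟩ else 0 with hX
    have hMX : ∀ i : Fin n, n - r ≤ (i : ℕ) → M.mulVec X i = 0 := by
      intro i hi
      have := congrFun hx ⟨i - (n - r), by omega⟩
      simp only [Matrix.mulVec, dotProduct, Matrix.submatrix_apply, Pi.zero_apply] at this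
      simp only [Matrix.mulVec, dotProduct, hX]
      rw [bbc_sum hr2, ← this]
      apply Finset.sum_congr rfl
      intro j _
      congr 2
      apply Fin.ext
      simp only
      omega
    have hd1 := (Matrix.isUnit_iff_isUnit_det _).mp h1
    have hd2 := (Matrix.isUnit_iff_isUnit_det _).mp h2
    have hY : (bbcW k n).mulVec (U₂.mulVec X) = U₁⁻¹.mulVec (M.mulVec X) := by
      rw [hMe, Matrix.mulVec_mulVec, Matrix.mulVec_mulVec, ← Matrix.mul_assoc, ← Matrix.mul_assoc,
        Matrix.nonsing_inv_mul _ hd1, Matrix.one_mul]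
    have hU2X : U₂.mulVec X = 0 := by
      funext l
      by_cases hl : (l : ℕ) < r
      · have := congrFun hY l.rev
        rw [bbc_Wvec, Fin.rev_rev] at this
        rw [this]
        rw [Pi.zero_apply]
        simp only [Matrix.mulVec.eq_1 U₁⁻¹, dotProduct]
        apply Finset.sum_eq_zero
        intro j _
        by_cases hj : j < l.rev
        · rw [bbc_inv U₁ h1 t1 _ _ hj, zero_mul]
        · rw [hMX j, mul_zero]
          have := l.isLt
          rw [Fin.lt_def, Fin.val_rev] at hj
          omega
      · rw [Pi.zero_apply]
        simp only [Matrix.mulVec, dotProduct]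
        apply Finset.sum_eq_zero
        intro j _
        by_cases hj : j < l
        · rw [t2 _ _ hj, zero_mul]
        · rw [Fin.lt_def] at hj
          simp only [hX]
          rw [dif_neg (by omega), mul_zero]
    have hX0 : X = 0 := by
      have : U₂⁻¹.mulVec (U₂.mulVec X) = X := by
        rw [Matrix.mulVec_mulVec, Matrix.nonsing_inv_mul _ hd2, Matrix.one_mulVec]
      rw [← this, hU2X, Matrix.mulVec_zero]
    funext j
    have := congrFun hX0 ⟨j, by omega⟩
    simpa [hX] using this
  · intro H
    have key : ∀ i : Fin n, ∃ X : Fin n → k, (∀ l, i < l → X l = 0) ∧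
        ∀ l : Fin n, i.rev ≤ l → M.mulVec X l = if l = i.rev then 1 else 0 := by
      intro i
      have hd := H (i + 1) (by omega) (by omega)
      set N := (M.submatrix
            (fun a : Fin (i + 1) => (⟨n - (i + 1) + a.val, by have := a.isLt; omega⟩ : Fin n))
            (fun j : Fin (i + 1) => (⟨j.val, by have := j.isLt; omega⟩ : Fin n))) with hN
      set x : Fin (i + 1) → k := N⁻¹.mulVec (Pi.single 0 1) with hx
      have hNx : N.mulVec x = Pi.single 0 1 := by
        rw [hx, Matrix.mulVec_mulVec, Matrix.mul_nonsing_inv _ (isUnit_iff_ne_zero.mpr hd),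
          Matrix.one_mulVec]
      refine ⟨fun l => if h : (l : ℕ) < i + 1 then x ⟨l, h⟩ else 0, ?_, ?_⟩
      · intro l hl
        rw [Fin.lt_def] at hl
        exact dif_neg (by omega)
      · intro l hl
        rw [Fin.le_def, Fin.val_rev] at hl
        have := congrFun hNx ⟨l - (n - (i + 1)), by omega⟩
        have e : (if l = i.rev then (1 : k) else 0)
            = (Pi.single 0 1 : Fin (i + 1) → k) ⟨l - (n - (i + 1)), by omega⟩ := by
          rw [Pi.single_apply]
          congr 1
          simp only [Fin.ext_iff, Fin.val_rev, Fin.val_zero, eq_iff_iff]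
          omega
        rw [e, ← this]
        simp only [Matrix.mulVec, dotProduct]
        rw [bbc_sum (by omega)]
        apply Finset.sum_congr rfl
        intro j _
        rw [hN, Matrix.submatrix_apply]
        congr 2
        apply Fin.ext
        simp only
        omega
    choose X hX1 hX2 using key
    set V : Matrix (Fin n) (Fin n) k := Matrix.of fun l i => X i l with hV
    have hMV : ∀ l i, (M * V) l i = M.mulVec (X i) l := fun l i => rfl
    have hU1 : ∀ i j : Fin n, j < i → (M * V * bbcW k n) i j = 0 := by
      intro i j hij
      rw [bbc_mulW, hMV, hX2 _ _ (by rw [Fin.rev_rev]; exact hij.le), Fin.rev_rev,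
        if_neg hij.ne']
    have hdet : (M * V * bbcW k n).det = 1 := by
      have ht : (M * V * bbcW k n).IsUpperTriangular := fun i j hij => hU1 i j hij
      rw [Matrix.det_of_isUpperTriangular ht]
      apply Finset.prod_eq_one
      intro i _
      rw [bbc_mulW, hMV, hX2 _ _ (by rw [Fin.rev_rev]), Fin.rev_rev, if_pos rfl]
    have hVd : IsUnit V.det := by
      rw [isUnit_iff_ne_zero]
      intro h0
      rw [Matrix.det_mul, Matrix.det_mul, h0] at hdet
      simp at hdet
    have hVu : IsUnit V := (Matrix.isUnit_iff_isUnit_det _).mpr hVd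
    refine ⟨M * V * bbcW k n, V⁻¹, ?_, ?_, hU1, ?_, ?_⟩
    · rw [Matrix.isUnit_iff_isUnit_det, hdet]; exact isUnit_one
    · exact (Matrix.isUnit_nonsing_inv_iff).mpr hVu
    · exact bbc_inv V hVu (fun i j hij => hX1 j i hij)
    · rw [Matrix.mul_assoc (M * V), bbcW_sq, Matrix.mul_one, Matrix.mul_assoc,
        Matrix.mul_nonsing_inv _ hVd, Matrix.mul_one]
end

section
/- For n ≥ 2, in the Coxeter system (W_n, {t_1,…,t_n}) of type B_n, the word 𝐰 = (t_n, t_{n−1}, …, t_2, t_1, t_2, …, t_{n−1}, t_n, t_{n−1}, …, t_2, t_1, t_2, …, t_{n−1}) of length 4n−4 is reduced, i.e. the length of the product t_n t_{n−1} ⋯ t_2 t_1 t_2 ⋯ t_{n−1} t_n t_{n−1} ⋯ t_2 t_1 t_2 ⋯ t_{n−1} equals 4n−4. -/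
namespace DeodharBn

/-- The Coxeter matrix of type Bₙ with the paper's convention:
`m(t₁,t₂) = 4`, `m(tᵢ,tᵢ₊₁) = 3` for `2 ≤ i ≤ n−1`, and `m(tᵢ,tⱼ) = 2` for `|i−j| ≥ 2`
(here `tᵢ` corresponds to the index `i - 1 : Fin n`). -/
def BnMatrix (n : ℕ) : CoxeterMatrix (Fin n) where
  M := Matrix.of fun i j : Fin n =>
    if (i : ℕ) = (j : ℕ) then 1
    else if ((i : ℕ) = 0 ∧ (j : ℕ) = 1) ∨ ((i : ℕ) = 1 ∧ (j : ℕ) = 0) then 4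
    else if (i : ℕ) + 1 = (j : ℕ) ∨ (j : ℕ) + 1 = (i : ℕ) then 3
    else 2
  isSymm := by
    unfold Matrix.IsSymm
    ext i j
    simp only [Matrix.transpose_apply, Matrix.of_apply]
    split_ifs <;> omega
  diagonal := fun i => by simp
  off_diagonal := fun i j h => by
    have h' : (i : ℕ) ≠ (j : ℕ) := fun hc => h (Fin.ext hc)
    simp only [Matrix.of_apply]
    split_ifs <;> omega

/-- The letter (as an index in `Fin n`, with `tᵢ` corresponding to `i - 1`) at position `i`
(`0`-based) of the word
`𝐰 = (tₙ, tₙ₋₁, …, t₂, t₁, t₂, …, tₙ₋₁, tₙ, tₙ₋₁, …, t₂, t₁, t₂, …, tₙ₋₁)`. -/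
def bLetter (n : ℕ) (hn : 2 ≤ n) (i : ℕ) : Fin n :=
  if _h : i % (2 * n - 2) ≤ n - 1 then
    ⟨n - 1 - i % (2 * n - 2), by omega⟩
  else
    ⟨i % (2 * n - 2) - n + 1, by
      have h2 : i % (2 * n - 2) < 2 * n - 2 := Nat.mod_lt _ (by omega)
      omega⟩

/-- The word `𝐰 = (tₙ, tₙ₋₁, …, t₂, t₁, t₂, …, tₙ₋₁, tₙ, tₙ₋₁, …, t₂, t₁, t₂, …, tₙ₋₁)`
of length `4n − 4`. -/
def bWord (n : ℕ) (hn : 2 ≤ n) : List (Fin n) :=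
  List.ofFn fun i : Fin (4 * n - 4) => bLetter n hn (i : ℕ)

/-- generators of type B acting on integer sequences -/
def genAct (i : ℕ) : Function.End (ℕ → ℤ) := fun v k =>
  if i = 0 then (if k = 0 then - v 0 else v k)
  else if k + 1 = i then v i else if k = i then v (i - 1) else v k

theorem genAct_sq (i : ℕ) : genAct i * genAct i = 1 := by
  funext v k
  simp only [Function.End.mul_def, Function.comp, Function.End.one_def, id, genAct]
  grind

theorem genAct_comm (i j : ℕ) (h : i + 2 ≤ j) :
    genAct i * genAct j = genAct j * genAct i := by
  funext v k
  simp only [Function.End.mul_def, Function.comp, genAct]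
  grind

theorem genAct_braid (i : ℕ) (h : 1 ≤ i) :
    genAct i * genAct (i + 1) * genAct i = genAct (i + 1) * genAct i * genAct (i + 1) := by
  funext v k
  show genAct i (genAct (i + 1) (genAct i v)) k = genAct (i + 1) (genAct i (genAct (i + 1) v)) k
  simp only [genAct]
  grind

theorem genAct_braid4 :
    genAct 0 * genAct 1 * genAct 0 * genAct 1 = genAct 1 * genAct 0 * genAct 1 * genAct 0 := by
  funext v k
  show genAct 0 (genAct 1 (genAct 0 (genAct 1 v))) k =
    genAct 1 (genAct 0 (genAct 1 (genAct 0 v))) k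
  simp only [genAct]
  grind

theorem pow_two_of {M : Type*} [Monoid M] {a b : M} (ha : a * a = 1) (hb : b * b = 1)
    (h : a * b = b * a) : (a * b) ^ 2 = 1 := by
  calc (a * b) ^ 2 = (a * b) * (a * b) := pow_two _
    _ = (a * b) * (b * a) := by rw [h]
    _ = a * (b * b) * a := by simp only [mul_assoc]
    _ = 1 := by rw [hb, mul_one, ha]

theorem pow_three_of {M : Type*} [Monoid M] {a b : M} (ha : a * a = 1) (hb : b * b = 1)
    (h : a * b * a = b * a * b) : (a * b) ^ 3 = 1 := by
  calc (a * b) ^ 3 = (a * b * a) * (b * a * b) := by simp only [pow_succ, pow_zero, one_mul, mul_assoc]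
    _ = (a * b * a) * (a * b * a) := by rw [h]
    _ = a * (b * (a * a) * b) * a := by simp only [mul_assoc]
    _ = 1 := by rw [ha, mul_one, hb, mul_one, ha]

theorem pow_four_of {M : Type*} [Monoid M] {a b : M} (ha : a * a = 1) (hb : b * b = 1)
    (h : a * b * a * b = b * a * b * a) : (a * b) ^ 4 = 1 := by
  calc (a * b) ^ 4 = (a * b * a * b) * (a * b * a * b) := by
        simp only [pow_succ, pow_zero, one_mul, mul_assoc]
    _ = (a * b * a * b) * (b * a * b * a) := by rw [h]
    _ = a * (b * (a * (b * b) * a) * b) * a := by simp only [mul_assoc]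
    _ = 1 := by rw [hb, mul_one, ha, mul_one, hb, mul_one, ha]

theorem genAct_liftable (n : ℕ) : (BnMatrix n).IsLiftable (fun i : Fin n => genAct (i : ℕ)) := by
  intro i j
  show (genAct i * genAct j) ^ (if (i : ℕ) = (j : ℕ) then 1
    else if ((i : ℕ) = 0 ∧ (j : ℕ) = 1) ∨ ((i : ℕ) = 1 ∧ (j : ℕ) = 0) then 4
    else if (i : ℕ) + 1 = (j : ℕ) ∨ (j : ℕ) + 1 = (i : ℕ) then 3
    else 2) = 1
  generalize (i : ℕ) = a
  generalize (j : ℕ) = b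
  split_ifs with h1 h2 h3
  · rw [h1, pow_one, genAct_sq]
  · apply pow_four_of (genAct_sq _) (genAct_sq _)
    rcases h2 with ⟨rfl, rfl⟩ | ⟨rfl, rfl⟩
    · exact genAct_braid4
    · exact genAct_braid4.symm
  · apply pow_three_of (genAct_sq _) (genAct_sq _)
    rcases h3 with rfl | rfl
    · exact genAct_braid _ (by omega)
    · exact (genAct_braid _ (by omega)).symm
  · apply pow_two_of (genAct_sq _) (genAct_sq _)
    rcases Nat.lt_or_ge a b with h | h
    · exact genAct_comm _ _ (by omega)
    · exact (genAct_comm _ _ (by omega)).symm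

/-- local contribution to twice the inversion number -/
def invF (i j : ℕ) (a b : ℤ) : ℕ :=
  if i = j then (if a < 0 then 2 else 0)
  else (if a + b < 0 then 1 else 0) +
    (if i < j then (if b < a then 1 else 0) else (if a < b then 1 else 0))

/-- twice the inversion number -/
def invD (n : ℕ) (v : ℕ → ℤ) : ℕ :=
  ∑ i ∈ Finset.range n, ∑ j ∈ Finset.range n, invF i j (v i) (v j)

theorem sum_point (n p q : ℕ) (c : ℕ) :
    ∑ i ∈ Finset.range n, ∑ j ∈ Finset.range n, (if i = p ∧ j = q then c else 0) ≤ c := by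
  simp only [ite_and]
  simp only [Finset.sum_ite_irrel, Finset.sum_ite_eq', Finset.sum_const_zero]
  split_ifs <;> simp

theorem sum_swap_range (n p : ℕ) (h : p + 1 < n) (f : ℕ → ℕ) :
    ∑ i ∈ Finset.range n, f i = ∑ i ∈ Finset.range n, f (Equiv.swap p (p + 1) i) := by
  symm
  apply Finset.sum_equiv (Equiv.swap p (p + 1))
  · intro i
    simp only [Finset.mem_range, Equiv.swap_apply_def]
    split_ifs <;> omega
  · intros; rfl

theorem invD_genAct (n i : ℕ) (h : i < n) (v : ℕ → ℤ) :
    invD n (genAct i v) ≤ invD n v + 2 := by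
  rcases i with _ | p
  · refine le_trans ?_ (Nat.add_le_add_left (sum_point n 0 0 2) _)
    unfold invD
    simp only [← Finset.sum_add_distrib]
    refine Finset.sum_le_sum fun i _ => Finset.sum_le_sum fun j _ => ?_
    simp only [genAct, invF]
    grind
  · have e : ∀ k, genAct (p + 1) v (Equiv.swap p (p + 1) k) = v k := by
      intro k
      simp only [genAct, Equiv.swap_apply_def]
      grind
    have e2 : invD n (genAct (p + 1) v) = ∑ i ∈ Finset.range n, ∑ j ∈ Finset.range n,
        invF (Equiv.swap p (p + 1) i) (Equiv.swap p (p + 1) j) (v i) (v j) := by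
      unfold invD
      rw [sum_swap_range n p h]
      refine Finset.sum_congr rfl fun i _ => ?_
      rw [sum_swap_range n p h]
      simp only [e]
    have h1 := sum_point n p (p + 1) 1
    have h2 := sum_point n (p + 1) p 1
    have h3 : invD n (genAct (p + 1) v) ≤ invD n v +
        (∑ i ∈ Finset.range n, ∑ j ∈ Finset.range n, (if i = p ∧ j = p + 1 then 1 else 0) +
        ∑ i ∈ Finset.range n, ∑ j ∈ Finset.range n, (if i = p + 1 ∧ j = p then 1 else 0)) := by
      rw [e2]
      unfold invD
      simp only [← Finset.sum_add_distrib]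
      refine Finset.sum_le_sum fun i _ => Finset.sum_le_sum fun j _ => ?_
      simp only [invF, Equiv.swap_apply_def]
      grind
    omega

theorem invD_prod (n : ℕ) (l : List (Fin n)) (v : ℕ → ℤ) :
    invD n ((l.map (fun i : Fin n => genAct (i : ℕ))).prod v) ≤ invD n v + 2 * l.length := by
  induction l with
  | nil => exact le_refl _
  | cons i l ih =>
    rw [List.map_cons, List.prod_cons, List.length_cons]
    have := invD_genAct n i i.2 ((l.map (fun i : Fin n => genAct (i : ℕ))).prod v)
    simp only [Function.End.mul_def, Function.comp]
    omega

theorem invD_start (n : ℕ) : invD n (fun k => (k : ℤ) + 1) = 0 := by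
  unfold invD
  refine Finset.sum_eq_zero fun i _ => Finset.sum_eq_zero fun j _ => ?_
  simp only [invF]
  grind

theorem invD_end (m : ℕ) :
    invD (m + 2) (fun k => if m ≤ k ∧ k < m + 2 then - ((k : ℤ) + 1) else (k : ℤ) + 1)
      = 2 * (4 * m + 4) := by
  have : invD (m + 2) (fun k => if m ≤ k ∧ k < m + 2 then - ((k : ℤ) + 1) else (k : ℤ) + 1)
      = ∑ i ∈ Finset.range (m + 2), ∑ j ∈ Finset.range (m + 2),
        (if i < m then (if j < m then 0 else 2) else 2) := by
    unfold invD
    refine Finset.sum_congr rfl fun i hi => Finset.sum_congr rfl fun j hj => ?_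
    simp only [Finset.mem_range] at hi hj
    simp only [invF]
    grind
  rw [this]
  have h1 : ∑ j ∈ Finset.range (m + 2), (if j < m then 0 else 2) = 4 := by
    rw [Finset.sum_range_succ, Finset.sum_range_succ, Finset.sum_eq_zero]
    · simp
    · intro j hj; simp at hj; simp [hj]
  simp only [Finset.sum_ite_irrel, h1]
  rw [Finset.sum_range_succ, Finset.sum_range_succ, Finset.sum_congr rfl (g := fun _ => 4)]
  · simp; ring
  · intro j hj; simp at hj; simp [hj]

theorem prod_up (k : ℕ) (v : ℕ → ℤ) :
    ((List.range k).map (fun i => genAct (i + 1))).prod v =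
      fun j => if j = 0 then v k else if j ≤ k then v (j - 1) else v j := by
  induction k generalizing v with
  | zero => funext j; simp [Function.End.one_def]; grind
  | succ k ih =>
    rw [List.range_succ, List.map_append, List.prod_append]
    simp only [List.map_cons, List.map_nil, List.prod_singleton, Function.End.mul_def,
      Function.comp, ih]
    funext j
    simp only [genAct]
    grind

theorem prod_down (k : ℕ) (v : ℕ → ℤ) :
    ((List.range (k + 1)).map (fun i => genAct (k - i))).prod v =
      fun j => if j < k then v (j + 1) else if j = k then - v 0 else v j := by
  induction k generalizing v with
  | zero => funext j; simp [genAct]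
  | succ k ih =>
    rw [List.range_succ_eq_map, List.map_cons, List.prod_cons, List.map_map]
    have : ((fun i => genAct (k + 1 - i)) ∘ Nat.succ) = fun i => genAct (k - i) := by
      funext i; simp
    rw [this]
    simp only [Function.End.mul_def, Function.comp, ih]
    funext j
    simp only [genAct]
    grind

/-- half of the word -/
def halfWord (m : ℕ) : List ℕ :=
  (List.range (m + 2)).map (fun i => m + 1 - i) ++ (List.range m).map (fun i => i + 1)

theorem bWord_eq (m : ℕ) (hn : 2 ≤ m + 2) :
    (bWord (m + 2) hn).map Fin.val = halfWord m ++ halfWord m := by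
  apply List.ext_getElem
  · simp [bWord, halfWord]; omega
  · intro i h1 h2
    simp [bWord] at h1
    have hm : i % (2 * (m + 2) - 2) = if i < 2 * m + 2 then i else i - (2 * m + 2) := by
      have : 2 * (m + 2) - 2 = 2 * m + 2 := by omega
      rw [this]
      split_ifs with h
      · exact Nat.mod_eq_of_lt h
      · rw [Nat.mod_eq_sub_mod (by omega), Nat.mod_eq_of_lt (by omega)]
    simp only [bWord, List.getElem_map, List.getElem_ofFn, bLetter, halfWord,
      List.getElem_append, List.getElem_range, List.length_append, List.length_map,
      List.length_range, apply_dite Fin.val, hm]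
    grind

theorem half_prod (m : ℕ) (v : ℕ → ℤ) :
    ((halfWord m).map genAct).prod v =
      fun j => if j = m then v (m + 1) else if j = m + 1 then - v m else v j := by
  have hu := prod_up m v
  have hd := prod_down (m + 1)
  simp only [halfWord, List.map_append, List.map_map, List.prod_append]
  show ((List.range (m + 1 + 1)).map (fun i => genAct (m + 1 - i))).prod
    (((List.range m).map (fun i => genAct (i + 1))).prod v) = _
  rw [hu, hd]
  funext j
  grind

theorem full_prod (m : ℕ) (hn : 2 ≤ m + 2) :
    ((bWord (m + 2) hn).map (fun i : Fin (m + 2) => genAct (i : ℕ))).prod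
      (fun k => (k : ℤ) + 1) =
      fun k => if m ≤ k ∧ k < m + 2 then - ((k : ℤ) + 1) else (k : ℤ) + 1 := by
  have : (bWord (m + 2) hn).map (fun i : Fin (m + 2) => genAct (i : ℕ)) =
      ((bWord (m + 2) hn).map Fin.val).map genAct := by
    rw [List.map_map]; rfl
  rw [this, bWord_eq, List.map_append, List.prod_append, Function.End.mul_def]
  simp only [Function.comp, half_prod]
  funext j
  grind

/-- **The word `𝐰` is reduced.**
For `n ≥ 2`, in the Coxeter system of type Bₙ, the length of the product
`tₙ tₙ₋₁ ⋯ t₂ t₁ t₂ ⋯ tₙ₋₁ tₙ tₙ₋₁ ⋯ t₂ t₁ t₂ ⋯ tₙ₋₁` equals `4n − 4`. -/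
theorem bWord_isReduced (n : ℕ) (hn : 2 ≤ n) {W : Type*} [Group W]
    (cs : CoxeterSystem (BnMatrix n) W) :
    cs.length (cs.wordProd (bWord n hn)) = 4 * n - 4 := by
  obtain ⟨m, rfl⟩ : ∃ m, n = m + 2 := ⟨n - 2, by omega⟩
  have key : ∀ l : List (Fin (m + 2)), cs.lift ⟨_, genAct_liftable (m + 2)⟩ (cs.wordProd l) =
      (l.map (fun i : Fin (m + 2) => genAct (i : ℕ))).prod := by
    intro l
    rw [CoxeterSystem.wordProd, map_list_prod, List.map_map]
    congr 1
    apply List.map_congr_left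
    intro i _
    exact cs.lift_apply_simple (genAct_liftable (m + 2)) i
  apply le_antisymm
  · refine (cs.length_wordProd_le _).trans ?_
    rw [bWord, List.length_ofFn]
  · obtain ⟨l, hl, he⟩ := cs.exists_isReduced (cs.wordProd (bWord (m + 2) hn))
    have h1 := invD_prod (m + 2) l (fun k => (k : ℤ) + 1)
    rw [← key, ← he, key, full_prod, invD_end, invD_start] at h1
    rw [he, hl.eq]
    omega

end DeodharBn
end

section
/- For n ≥ 2, in the Coxeter system (W_n, {t_1,…,t_n}) of type B_n, consider the reduced word 𝐰 = (t_n, t_{n−1}, …, t_2, t_1, t_2, …, t_{n−1}, t_n, t_{n−1}, …, t_2, t_1, t_2, …, t_{n−1}) of length 4n−4 and its subexpression γ = (1, t_{n−1}, …, t_2, 1, t_2, …, t_{n−1}, 1, t_{n−1}, …, t_2, 1, t_2, …, t_{n−1}) (i.e. γ_i = 1 at the four positions where the letter of 𝐰 is t_n or t_1, and γ_i equals the letter of 𝐰 at every other position). Then: (a) γ is distinguished; (b) the total product γ^{4n−4} equals the identity of W_n; (c) |I(γ)| = 4n−8; (d) |J(γ)| = 2n−4. Consequently the associated Deodhar cell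 k^{|I(γ)|−|J(γ)|} × (kˣ)^{(4n−4)−|I(γ)|} has dimension (4n−4) − |J(γ)| = 2n. -/
namespace DeodharBn

variable {n : ℕ} (hn : 2 ≤ n) {W : Type*} [Group W] (cs : CoxeterSystem (BnMatrix n) W)

/-- The subexpression of `𝐰` encoded by `b : Fin (4n−4) → Bool`:
entry `i` is the letter of `𝐰` at position `i` if `b i = true` and `1` otherwise. -/
def subexpr (b : Fin (4 * n - 4) → Bool) : Fin (4 * n - 4) → W :=
  fun i => if b i then cs.simple (bLetter n hn (i : ℕ)) else 1

/-- The partial product `γ^m = γ₁ ⋯ γₘ` (product of the first `m` entries) of the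
subexpression encoded by `b`. -/
def partialProd (b : Fin (4 * n - 4) → Bool) (m : ℕ) : W :=
  ((List.ofFn (subexpr hn cs b)).take m).prod

/-- The subexpression encoded by `b` is distinguished:
`ℓ(γ^{i−1} s_{a i}) < ℓ(γ^{i−1})` implies `γ i = s_{a i}`. -/
def Distinguished (b : Fin (4 * n - 4) → Bool) : Prop :=
  ∀ i : Fin (4 * n - 4),
    cs.length (partialProd hn cs b (i : ℕ) * cs.simple (bLetter n hn (i : ℕ))) <
      cs.length (partialProd hn cs b (i : ℕ)) → b i = true

/-- `|I(γ)|`, the number of positions where the subexpression entry equals the letter of the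
word (rather than `1`). -/
def cardI (b : Fin (4 * n - 4) → Bool) : ℕ :=
  (Finset.univ.filter fun i : Fin (4 * n - 4) => b i = true).card

/-- `|J(γ)|`, the number of positions `i` with `ℓ(γ^i s_{a i}) < ℓ(γ^i)`. -/
noncomputable def cardJ (b : Fin (4 * n - 4) → Bool) : ℕ :=
  (Finset.univ.filter fun i : Fin (4 * n - 4) =>
    cs.length (partialProd hn cs b ((i : ℕ) + 1) * cs.simple (bLetter n hn (i : ℕ))) <
      cs.length (partialProd hn cs b ((i : ℕ) + 1))).card

/-- The Boolean encoding of the subexpression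
`γ = (1, tₙ₋₁, …, t₂, 1, t₂, …, tₙ₋₁, 1, tₙ₋₁, …, t₂, 1, t₂, …, tₙ₋₁)` of `𝐰`:
`γ i = 1` precisely at the positions where the letter of `𝐰` is `t₁` or `tₙ`. -/
def gammaSel (n : ℕ) (hn : 2 ≤ n) (i : Fin (4 * n - 4)) : Bool :=
  decide (¬((bLetter n hn (i : ℕ) : ℕ) = 0 ∨ (bLetter n hn (i : ℕ) : ℕ) = n - 1))

theorem mod_cases (n m : ℕ) (hn : 2 ≤ n) (hm : m < 4 * n - 4) :
    (m < 2 * n - 2 ∧ m % (2 * n - 2) = m) ∨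
    (2 * n - 2 ≤ m ∧ m % (2 * n - 2) = m - (2 * n - 2)) := by
  rcases lt_or_ge m (2 * n - 2) with h | h
  · exact Or.inl ⟨h, Nat.mod_eq_of_lt h⟩
  · refine Or.inr ⟨h, ?_⟩
    rw [Nat.mod_eq_sub_mod h, Nat.mod_eq_of_lt (by omega)]

theorem bLetter_val (n : ℕ) (hn : 2 ≤ n) (i : ℕ) :
    (bLetter n hn i : ℕ) = if i % (2 * n - 2) ≤ n - 1 then n - 1 - i % (2 * n - 2)
      else i % (2 * n - 2) - n + 1 := by
  unfold bLetter
  split_ifs <;> rfl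

/-- The descending products. -/
def DW (n : ℕ) (hn : 2 ≤ n) (j : ℕ) : List (Fin n) := (List.range j).map fun k => bLetter n hn (k + 1)

theorem DW_eq (j : ℕ) (hj : j ≤ n - 1) : DW n hn j = ((bWord n hn).drop 1).take j := by
  apply List.ext_getElem
  · simp [DW, bWord]; omega
  · intro i h1 h2
    simp [DW, bWord, add_comm]

/-- The element of the descending word. -/
def DP (j : ℕ) : W := cs.wordProd (DW n hn j)

theorem DP_zero : DP hn cs 0 = 1 := by simp [DP, DW]

theorem DP_succ (j : ℕ) : DP hn cs (j + 1) = DP hn cs j * cs.simple (bLetter n hn (j + 1)) := by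
  simp [DP, DW, List.range_succ, CoxeterSystem.wordProd_append]

theorem DP_length (hred : cs.IsReduced (bWord n hn)) (j : ℕ) (hj : j ≤ n - 1) :
    cs.length (DP hn cs j) = j := by
  have h : cs.IsReduced (DW n hn j) := by
    rw [DW_eq hn j hj]
    exact (hred.drop 1).take j
  have : (DW n hn j).length = j := by simp [DW]
  rw [DP, h, this]

/-- Number of letters remaining. -/
def ff (n m : ℕ) : ℕ :=
  if m % (2 * n - 2) ≤ n - 1 then m % (2 * n - 2) - 1 else 2 * n - 2 - m % (2 * n - 2)

theorem pp_succ (b : Fin (4 * n - 4) → Bool) (m : ℕ) (hm : m < 4 * n - 4) :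
    partialProd hn cs b (m + 1) = partialProd hn cs b m * subexpr hn cs b ⟨m, hm⟩ := by
  unfold partialProd
  rw [List.prod_take_succ _ _ (by simpa using hm)]
  simp

theorem mod_succ (n m : ℕ) (hn : 2 ≤ n) :
    (m + 1) % (2 * n - 2) = if m % (2 * n - 2) + 1 = 2 * n - 2 then 0 else m % (2 * n - 2) + 1 := by
  have hlt : m % (2 * n - 2) < 2 * n - 2 := Nat.mod_lt _ (by omega)
  rw [Nat.add_mod_eq_ite]
  rcases Nat.lt_or_ge 1 (2 * n - 2) with h | h
  · rw [Nat.mod_eq_of_lt h]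
    split_ifs <;> omega
  · omega

theorem step (m : ℕ) (hm : m < 4 * n - 4) :
    DP hn cs (ff n (m + 1)) = DP hn cs (ff n m) * subexpr hn cs (gammaSel n hn) ⟨m, hm⟩ := by
  have hlt : m % (2 * n - 2) < 2 * n - 2 := Nat.mod_lt _ (by omega)
  have hv := bLetter_val n hn m
  have hs := mod_succ n m hn
  by_cases hg : gammaSel n hn ⟨m, hm⟩ = true
  · have hg' := hg
    simp only [gammaSel, decide_eq_true_eq] at hg'
    simp only [subexpr, hg, if_true]
    by_cases hq : m % (2 * n - 2) ≤ n - 1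
    · have e : ff n (m + 1) = ff n m + 1 := by
        unfold ff; split_ifs at * <;> omega
      rw [e, DP_succ]
      congr 2
      have e2 : ff n m + 1 = m % (2 * n - 2) := by
        unfold ff; split_ifs at * <;> omega
      apply Fin.ext
      rw [bLetter_val, bLetter_val, e2, Nat.mod_mod]
    · have e : ff n m = ff n (m + 1) + 1 := by
        unfold ff; split_ifs at * <;> omega
      rw [e, DP_succ]
      have e2 : bLetter n hn (ff n (m + 1) + 1) = bLetter n hn m := by
        have e3 : ff n (m + 1) + 1 = 2 * n - 2 - m % (2 * n - 2) := by
          rw [← e]; unfold ff; split_ifs at * <;> omega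
        have e4 : (2 * n - 2 - m % (2 * n - 2)) % (2 * n - 2) = 2 * n - 2 - m % (2 * n - 2) :=
          Nat.mod_eq_of_lt (by omega)
        apply Fin.ext
        rw [bLetter_val, e3, e4, hv]
        split_ifs <;> omega
      rw [e2]
      simp
  · have hg' := hg
    simp only [gammaSel, decide_eq_true_eq] at hg'
    simp only [subexpr, hg]
    have e : ff n (m + 1) = ff n m := by
      unfold ff; split_ifs at * <;> omega
    simp [e]

theorem pp_eq (m : ℕ) (hm : m ≤ 4 * n - 4) :
    partialProd hn cs (gammaSel n hn) m = DP hn cs (ff n m) := by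
  induction m with
  | zero => simp [partialProd, ff, DP_zero]
  | succ m ih => rw [pp_succ hn cs _ m (by omega), ih (by omega), step]

theorem ext_right (hred : cs.IsReduced (bWord n hn)) (m j : ℕ) (hj : j + 1 ≤ n - 1)
    (hl : (bLetter n hn m : ℕ) = n - 2 - j) :
    ¬ cs.length (DP hn cs j * cs.simple (bLetter n hn m)) < cs.length (DP hn cs j) := by
  have e : bLetter n hn m = bLetter n hn (j + 1) := by
    apply Fin.ext
    rw [hl, bLetter_val, Nat.mod_eq_of_lt (by omega), if_pos hj]
    omega
  rw [e, ← DP_succ, DP_length hn cs hred _ hj, DP_length hn cs hred _ (by omega)]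
  omega

theorem ext_left (hred : cs.IsReduced (bWord n hn)) (m j : ℕ) (hj : j + 1 ≤ n - 1)
    (hl : (bLetter n hn m : ℕ) = n - 2 - j) :
    cs.length (DP hn cs (j + 1) * cs.simple (bLetter n hn m)) < cs.length (DP hn cs (j + 1)) := by
  have e : bLetter n hn m = bLetter n hn (j + 1) := by
    apply Fin.ext
    rw [hl, bLetter_val, Nat.mod_eq_of_lt (by omega), if_pos hj]
    omega
  rw [DP_length hn cs hred _ hj, e, DP_succ, CoxeterSystem.simple_mul_simple_cancel_right,
    DP_length hn cs hred _ (by omega)]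
  omega

theorem one_case (m : ℕ) :
    ¬ cs.length (DP hn cs 0 * cs.simple (bLetter n hn m)) < cs.length (DP hn cs 0) := by
  simp [DP_zero]

theorem dist (hred : cs.IsReduced (bWord n hn)) : Distinguished hn cs (gammaSel n hn) := by
  rintro ⟨m, hm⟩ h
  by_contra hg
  simp only [gammaSel, decide_eq_true_eq] at hg
  revert h
  have hlt : m % (2 * n - 2) < 2 * n - 2 := Nat.mod_lt _ (by omega)
  have hv := bLetter_val n hn m
  simp only
  rw [pp_eq hn cs m (by omega)]
  by_cases h0 : m % (2 * n - 2) = 0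
  · have : ff n m = 0 := by simp [ff, h0]
    rw [this]
    exact one_case hn cs m
  · apply ext_right hn cs hred
    · unfold ff; split_ifs at * <;> omega
    · unfold ff; split_ifs at * <;> omega

theorem J_iff (hred : cs.IsReduced (bWord n hn)) (m : ℕ) (hm : m < 4 * n - 4) :
    cs.length (partialProd hn cs (gammaSel n hn) (m + 1) * cs.simple (bLetter n hn m)) <
      cs.length (partialProd hn cs (gammaSel n hn) (m + 1)) ↔
    (1 ≤ m % (2 * n - 2) ∧ m % (2 * n - 2) < n - 1) := by
  have hlt : m % (2 * n - 2) < 2 * n - 2 := Nat.mod_lt _ (by omega)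
  have hv := bLetter_val n hn m
  have hs := mod_succ n m hn
  rw [pp_eq hn cs (m + 1) (by omega)]
  by_cases h : 1 ≤ m % (2 * n - 2) ∧ m % (2 * n - 2) < n - 1
  · refine iff_of_true ?_ h
    have e : ff n (m + 1) = (m % (2 * n - 2) - 1) + 1 := by
      unfold ff; split_ifs at * <;> omega
    rw [e]
    apply ext_left hn cs hred
    · omega
    · split_ifs at * <;> omega
  · refine iff_of_false ?_ h
    by_cases h0 : m % (2 * n - 2) = 0
    · have : ff n (m + 1) = 0 := by
        unfold ff; split_ifs at * <;> omega
      rw [this]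
      exact one_case hn cs m
    · apply ext_right hn cs hred
      · unfold ff; split_ifs at * <;> omega
      · unfold ff; split_ifs at * <;> omega

theorem card_J (hred : cs.IsReduced (bWord n hn)) : cardJ hn cs (gammaSel n hn) = 2 * n - 4 := by
  unfold cardJ
  rw [← Finset.card_map Fin.valEmbedding]
  have : (Finset.univ.filter fun i : Fin (4 * n - 4) =>
      cs.length (partialProd hn cs (gammaSel n hn) ((i : ℕ) + 1) *
        cs.simple (bLetter n hn (i : ℕ))) <
      cs.length (partialProd hn cs (gammaSel n hn) ((i : ℕ) + 1))).map Fin.valEmbedding =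
      Finset.Ico 1 (n - 1) ∪ Finset.Ico (2 * n - 1) (3 * n - 3) := by
    ext m
    simp only [Finset.mem_map, Finset.mem_filter, Finset.mem_univ, true_and,
      Fin.valEmbedding_apply, Finset.mem_union, Finset.mem_Ico]
    constructor
    · rintro ⟨⟨i, hi⟩, h, rfl⟩
      rw [J_iff hn cs hred i hi] at h
      have := mod_cases n i hn hi
      simp only
      omega
    · intro h
      have hm : m < 4 * n - 4 := by omega
      refine ⟨⟨m, hm⟩, ?_, rfl⟩
      rw [J_iff hn cs hred m hm]
      have := mod_cases n m hn hm
      omega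
  rw [this, Finset.card_union_of_disjoint]
  · simp only [Nat.card_Ico]; omega
  · rw [Finset.disjoint_left]
    intro a
    simp only [Finset.mem_Ico]
    omega

theorem card_I : cardI (gammaSel n hn) = 4 * n - 8 := by
  have key : (Finset.univ.filter fun i : Fin (4 * n - 4) => ¬ gammaSel n hn i = true).map
      Fin.valEmbedding = {0, n - 1, 2 * n - 2, 3 * n - 3} := by
    ext m
    simp only [Finset.mem_map, Finset.mem_filter, Finset.mem_univ, true_and,
      Fin.valEmbedding_apply, Finset.mem_insert, Finset.mem_singleton, gammaSel,
      decide_eq_true_eq, not_not]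
    constructor
    · rintro ⟨⟨i, hi⟩, h, rfl⟩
      have := mod_cases n i hn hi
      have hv := bLetter_val n hn i
      simp only at h ⊢
      split_ifs at hv <;> omega
    · intro h
      have hm : m < 4 * n - 4 := by omega
      refine ⟨⟨m, hm⟩, ?_, rfl⟩
      have := mod_cases n m hn hm
      have hv := bLetter_val n hn m
      simp only
      split_ifs at hv <;> omega
  have h4 : (Finset.univ.filter fun i : Fin (4 * n - 4) => ¬ gammaSel n hn i = true).card = 4 := by
    rw [← Finset.card_map Fin.valEmbedding, key]
    rw [Finset.card_insert_of_notMem, Finset.card_insert_of_notMem, Finset.card_insert_of_notMem,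
      Finset.card_singleton]
    all_goals simp only [Finset.mem_insert, Finset.mem_singleton]; omega
  have := Finset.card_filter_add_card_filter_not (s := (Finset.univ : Finset (Fin (4 * n - 4))))
    (fun i => gammaSel n hn i = true)
  rw [h4, Finset.card_univ, Fintype.card_fin] at this
  unfold cardI
  omega

theorem prod_one : (List.ofFn (subexpr hn cs (gammaSel n hn))).prod = 1 := by
  have h := pp_eq hn cs (4 * n - 4) le_rfl
  have e : (4 * n - 4) % (2 * n - 2) = 0 := by
    have : 4 * n - 4 = (2 * n - 2) * 2 := by omega
    rw [this, Nat.mul_mod_right]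
  have e2 : ff n (4 * n - 4) = 0 := by simp [ff, e]
  rw [e2, DP_zero, partialProd, List.take_of_length_le (by simp)] at h
  exact h

/-- **The `2n`-dimensional Deodhar cell of the paper.**
For `n ≥ 2`, the subexpression `γ` of the reduced word `𝐰` is distinguished, its total
product is the identity, `|I(γ)| = 4n − 8`, `|J(γ)| = 2n − 4`, and consequently the
associated Deodhar cell `k^{|I(γ)|−|J(γ)|} × (kˣ)^{(4n−4)−|I(γ)|}` has dimension
`(4n−4) − |J(γ)| = 2n`. -/
theorem gamma_distinguished_card (hred : cs.IsReduced (bWord n hn)) :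
    Distinguished hn cs (gammaSel n hn) ∧
    (List.ofFn (subexpr hn cs (gammaSel n hn))).prod = 1 ∧
    cardI (gammaSel n hn) = 4 * n - 8 ∧
    cardJ hn cs (gammaSel n hn) = 2 * n - 4 ∧
    (cardI (gammaSel n hn) - cardJ hn cs (gammaSel n hn)) +
      ((4 * n - 4) - cardI (gammaSel n hn)) = 2 * n ∧
    (4 * n - 4) - cardJ hn cs (gammaSel n hn) = 2 * n := by
  have hI := card_I hn
  have hJ := card_J hn cs hred
  refine ⟨dist hn cs hred, prod_one hn cs, hI, hJ, ?_, ?_⟩ <;> omega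

end DeodharBn
end

section
/- Let n ≥ 2 and, in ℝⁿ with standard basis e_1,…,e_n, let Φ = {±e_i : 1 ≤ i ≤ n} ∪ {±e_i ± e_j : 1 ≤ i < j ≤ n} be the root system of type B_n, and let Ψ = {−e_{n−1} − e_n} ∪ {e_j − e_n : 1 ≤ j ≤ n−1}. Then for all α, β ∈ Ψ (not necessarily distinct), α + β ∉ Φ. -/
/-- **Pairwise sums within `Ψ` are not roots in type Bₙ.**
Let `n ≥ 2` and, in `ℝⁿ` with standard basis `e_0, …, e_{n−1}` (`0`-based; the paper's
`e_i` is `e_{i−1}` here), let `Φ = {±e_i} ∪ {±e_i ± e_j : i < j}` be the root system of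
type Bₙ and let `Ψ = {−e_{n−2} − e_{n−1}} ∪ {e_j − e_{n−1} : 0 ≤ j ≤ n−2}` (the paper's
`{−e_{n−1} − e_n} ∪ {e_j − e_n : 1 ≤ j ≤ n−1}`). Then for all `α, β ∈ Ψ`, not necessarily
distinct, `α + β ∉ Φ`. -/
theorem sum_of_psi_not_in_Bn_roots (n : ℕ) (hn : 2 ≤ n) :
    let e : Fin n → (Fin n → ℝ) := fun i => Pi.single i 1
    let Φ : Set (Fin n → ℝ) :=
      {v | ∃ i : Fin n, v = e i ∨ v = -e i} ∪
      {v | ∃ i j : Fin n, i < j ∧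
        (v = e i + e j ∨ v = e i - e j ∨ v = -e i + e j ∨ v = -e i - e j)}
    let Ψ : Set (Fin n → ℝ) :=
      insert (-(e ⟨n - 2, by omega⟩ + e ⟨n - 1, by omega⟩))
        {v | ∃ j : Fin n, (j : ℕ) ≤ n - 2 ∧ v = e j - e ⟨n - 1, by omega⟩}
    ∀ α ∈ Ψ, ∀ β ∈ Ψ, α + β ∉ Φ := by
  intro e Φ Ψ
  have he : ∀ i k : Fin n, e i k = if k = i then 1 else 0 := fun i k => by
    simp [e, Pi.single_apply]
  have h1 : ∀ α ∈ Ψ, α ⟨n - 1, by omega⟩ = -1 := by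
    rintro α (rfl | ⟨j, hj, rfl⟩)
    · have : n - 1 ≠ n - 2 := by omega
      simp [he, this]
    · have : (⟨n - 1, by omega⟩ : Fin n) ≠ j := by
        intro h
        have h' := congrArg Fin.val h
        simp only at h'
        omega
      simp [he, this]
  have h2 : ∀ v ∈ Φ, ∀ k, -1 ≤ v k := by
    rintro v (⟨i, h⟩ | ⟨i, j, hij, h⟩) k
    · rcases h with rfl | rfl <;> simp only [Pi.neg_apply, he] <;> split_ifs <;> norm_num
    · have hne : i ≠ j := hij.ne
      rcases h with rfl | rfl | rfl | rfl <;>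
        simp only [Pi.neg_apply, Pi.add_apply, Pi.sub_apply, he] <;> split_ifs <;>
        first
          | norm_num; done
          | (exfalso; apply hne; simp_all)
  intro α hα β hβ h
  have h3 := h2 _ h ⟨n - 1, by omega⟩
  rw [Pi.add_apply, h1 α hα, h1 β hβ] at h3
  norm_num at h3
end
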